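/- arXiv:math/0507075 — 2 statements merged into one kernel-verified Lean document; each statement's English description precedes it below -/
import Mathlib

section
/- For the orthogonal group O(n) acting diagonally on ⊗^{2l} ℝ^n, the subspace of invariant elements is spanned by the tensors obtained from complete pairings: for each permutation (i₁,…,i_{2l}) of (1,…,2l), the element corresponding to the multilinear form (v₁,…,v_{2l}) ↦ ⟨v_{i₁},v_{i₂}⟩⋯⟨v_{i_{2l-1}},v_{i_{2l}}⟩ under the identification of ⊗^{2l}V with its dual via the inner product. -/
open scoped TensorProduct

/-- The `k`-th tensor power of `ℝⁿ`. -/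
noncomputable abbrev TPow (n k : ℕ) : Type := ⨂[ℝ] _ : Fin k, (Fin n → ℝ)

/-- The diagonal (tensorial) action of a matrix `A` on `⊗^k ℝⁿ`. -/
noncomputable def tact {n k : ℕ} (A : Matrix (Fin n) (Fin n) ℝ) :
    TPow n k →ₗ[ℝ] TPow n k :=
  PiTensorProduct.map fun _ => A.mulVecLin

/-- The invariant tensor of `⊗^{2l} ℝⁿ` corresponding, under the identification of
`⊗^{2l}V` with its dual via the standard inner product, to the complete pairing form
`(v₁,…,v_{2l}) ↦ ⟨v_{σ(1)},v_{σ(2)}⟩ ⋯ ⟨v_{σ(2l-1)},v_{σ(2l)}⟩` determined by the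
permutation `σ` of `{1,…,2l}`: the positions `σ(2m)` and `σ(2m+1)` carry the same
basis index, which is summed over. -/
noncomputable def pairTensor (n l : ℕ) (σ : Equiv.Perm (Fin (2 * l))) : TPow n (2 * l) :=
  ∑ j : Fin l → Fin n, PiTensorProduct.tprod ℝ
    (fun p => Pi.single (j ⟨(σ.symm p : ℕ) / 2, by have := (σ.symm p).isLt; omega⟩)
      (1 : ℝ) : (p : Fin (2 * l)) → Fin n → ℝ)


namespace FFT

open Function Finset

section core
set_option linter.unusedSectionVars false

variable {n : ℕ} {ι : Type} [Fintype ι] [DecidableEq ι]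

def act (A : Matrix (Fin n) (Fin n) ℝ) (f : (ι → Fin n) → ℝ) : (ι → Fin n) → ℝ :=
  fun I => ∑ J : ι → Fin n, (∏ p, A (I p) (J p)) * f J

def Inv (f : (ι → Fin n) → ℝ) : Prop :=
  ∀ A ∈ Matrix.orthogonalGroup (Fin n) ℝ, act A f = f

lemma inv_perm {f : (ι → Fin n) → ℝ} (hf : Inv f) (σ : Equiv.Perm ι) :
    Inv (fun I => f (I ∘ σ)) := by
  intro A hA
  funext I
  have h := congrFun (hf A hA) (I ∘ σ)
  unfold act at h ⊢
  rw [← h]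
  rw [← Equiv.sum_comp (Equiv.arrowCongr σ (Equiv.refl (Fin n)))]
  refine Finset.sum_congr rfl fun J _ => ?_
  congr 1
  · rw [← Equiv.prod_comp σ]
    simp
  · change f _ = f _
    congr 1
    funext p
    simp

/-- sign condition -/
lemma inv_sign {f : (ι → Fin n) → ℝ} (hf : Inv f) (i : Fin n) (I : ι → Fin n) :
    (∏ p, (if I p = i then (-1 : ℝ) else 1)) * f I = f I := by
  have hA : Matrix.diagonal (fun j : Fin n => if j = i then (-1 : ℝ) else 1) ∈
      Matrix.orthogonalGroup (Fin n) ℝ := by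
    rw [Matrix.mem_orthogonalGroup_iff]
    rw [Matrix.diagonal_transpose, Matrix.diagonal_mul_diagonal]
    rw [← Matrix.diagonal_one]
    congr 1
    funext j
    by_cases h : j = i <;> simp [h]
  have h := congrFun (hf _ hA) I
  unfold act at h
  rw [Finset.sum_eq_single I] at h
  · simpa using h
  · intro J _ hJ
    obtain ⟨p, hp⟩ := Function.ne_iff.1 hJ
    rw [Finset.prod_eq_zero (Finset.mem_univ p), zero_mul]
    exact Matrix.diagonal_apply_ne _ (Ne.symm hp)
  · simp

lemma prod_erase_delta (I J : ι → Fin n) (p : ι) :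
    (∏ q ∈ univ.erase p, (1 : Matrix (Fin n) (Fin n) ℝ) (I q) (J q)) =
      if J = update I p (J p) then 1 else 0 := by
  split_ifs with h
  · refine Finset.prod_eq_one fun q hq => ?_
    have : J q = I q := by
      rw [h]; simp [(Finset.mem_erase.1 hq).1]
    rw [this]; simp
  · have : ∃ q, q ≠ p ∧ I q ≠ J q := by
      by_contra hc
      push Not at hc
      apply h
      funext q
      by_cases hq : q = p
      · subst hq; simp
      · simp [hq, hc q hq]
    obtain ⟨q, hq, hne⟩ := this
    refine Finset.prod_eq_zero (Finset.mem_erase.2 ⟨hq, Finset.mem_univ q⟩) ?_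
    exact Matrix.one_apply_ne hne

/-- infinitesimal invariance -/
lemma inv_deriv {f : (ι → Fin n) → ℝ} (hf : Inv f) (A : ℝ → Matrix (Fin n) (Fin n) ℝ)
    (X : Matrix (Fin n) (Fin n) ℝ) (hA : ∀ t, A t ∈ Matrix.orthogonalGroup (Fin n) ℝ)
    (h0 : A 0 = 1) (hX : ∀ i j, HasDerivAt (fun t => A t i j) (X i j) 0) (I : ι → Fin n) :
    ∑ p, ∑ j, X (I p) j * f (update I p j) = 0 := by
  have h1 : HasDerivAt (fun t => act (A t) f I)
      (∑ J : ι → Fin n, (∑ p, (∏ q ∈ univ.erase p, A 0 (I q) (J q)) • X (I p) (J p)) * f J) 0 := by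
    unfold act
    refine HasDerivAt.fun_sum fun J _ => ?_
    refine HasDerivAt.mul_const ?_ _
    exact HasDerivAt.fun_finsetProd fun p _ => hX _ _
  have h2 : (fun t => act (A t) f I) = fun _ => f I := by
    funext t; rw [hf _ (hA t)]
  rw [h2] at h1
  have h3 := h1.unique (hasDerivAt_const _ _)
  refine Eq.trans ?_ h3
  rw [h0]
  simp_rw [Finset.sum_mul]
  symm
  rw [Finset.sum_comm]
  refine Finset.sum_congr rfl fun p _ => ?_
  simp_rw [prod_erase_delta]
  refine (Finset.sum_subset (Finset.subset_univ (univ.image (fun j => update I p j))) ?_).symm.trans ?_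
  · intro J _ hJ
    rw [if_neg]
    · simp
    · intro h
      exact hJ (Finset.mem_image.2 ⟨J p, Finset.mem_univ _, h.symm⟩)
  · rw [Finset.sum_image]
    · simp
    · intro x _ y _ hxy
      simpa using congrFun hxy p

noncomputable def rot (i j : Fin n) (t : ℝ) : Matrix (Fin n) (Fin n) ℝ := fun x y =>
  if x = i then (if y = i then Real.cos t else if y = j then Real.sin t else 0)
  else if x = j then (if y = i then - Real.sin t else if y = j then Real.cos t else 0)
  else if x = y then 1 else 0

lemma rot_mem {i j : Fin n} (hij : i ≠ j) (t : ℝ) :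
    rot i j t ∈ Matrix.orthogonalGroup (Fin n) ℝ := by
  rw [Matrix.mem_orthogonalGroup_iff]
  have hc := Real.sin_sq_add_cos_sq t
  have key : ∀ x y : Fin n, ∀ g : Fin n → ℝ, (∀ z, z ≠ i → z ≠ j → g z = 0) →
      ∑ z, g z = g i + g j := by
    intro x y g hg
    rw [← Finset.sum_pair hij]
    symm
    refine Finset.sum_subset (Finset.subset_univ _) ?_
    intro z _ hz
    simp only [Finset.mem_insert, Finset.mem_singleton, not_or] at hz
    exact hg z hz.1 hz.2
  ext x y
  rw [Matrix.mul_apply]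
  simp only [Matrix.transpose_apply]
  by_cases hx : x = i ∨ x = j
  · rw [key x y]
    · by_cases hy : y = i ∨ y = j
      · rcases hx with rfl | rfl <;> rcases hy with rfl | rfl <;>
          simp [rot, hij, hij.symm, Matrix.one_apply] <;> nlinarith
      · push Not at hy
        have hyx : x ≠ y := by rintro rfl; tauto
        rw [Matrix.one_apply_ne hyx]
        simp [rot, hy.1, hy.2]
    · intro z hz1 hz2
      rcases hx with rfl | rfl <;> simp [rot, hz1, hz2]
  · push Not at hx
    rw [Finset.sum_eq_single x]
    · by_cases hxy : x = y
      · subst hxy; simp [rot, hx.1, hx.2]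
      · rw [Matrix.one_apply_ne hxy]
        simp [rot, hx.1, hx.2, Ne.symm hxy]
    · intro z _ hz
      simp [rot, hx.1, hx.2, Ne.symm hz]
    · simp

lemma inv_lie {f : (ι → Fin n) → ℝ} (hf : Inv f) (i j : Fin n) (I : ι → Fin n) :
    ∑ p, (if I p = i then f (update I p j) else 0) =
      ∑ p, (if I p = j then f (update I p i) else 0) := by
  by_cases hij : i = j
  · subst hij; rfl
  have h := inv_deriv hf (rot i j)
    (fun x y => if x = i then (if y = j then 1 else 0)
      else if x = j then (if y = i then -1 else 0) else 0) (rot_mem hij)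
    (by
      ext x y
      by_cases hx : x = i
      · subst hx
        by_cases hy : y = x
        · subst hy; simp [rot]
        · simp [rot, hy, Matrix.one_apply_ne (Ne.symm hy)]
      · by_cases hxj : x = j
        · subst hxj
          by_cases hy : y = x
          · subst hy; simp [rot, hx]
          · simp [rot, hy, hx, Matrix.one_apply_ne (Ne.symm hy)]
        · simp [rot, hx, hxj, Matrix.one_apply])
    (by
      intro x y
      unfold rot
      have hs : HasDerivAt Real.sin 1 0 := by simpa using Real.hasDerivAt_sin 0
      have hc : HasDerivAt Real.cos 0 0 := by simpa using Real.hasDerivAt_cos 0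
      split_ifs <;> first
        | exact hs
        | exact hc
        | exact hasDerivAt_const _ _
        | exact hs.fun_neg
        | (exfalso; subst_vars; simp_all)) I
  rw [← sub_eq_zero, ← Finset.sum_sub_distrib]
  refine Eq.trans ?_ h
  refine Finset.sum_congr rfl fun p _ => ?_
  by_cases h1 : I p = i
  · have : I p ≠ j := by rw [h1]; exact hij
    simp [h1, hij]
  · by_cases h2 : I p = j
    · simp [h2, Ne.symm hij]
    · simp [h1, h2]

/-- Jucys-Murphy condition -/
def JM (f : (ι → Fin n) → ℝ) : Prop :=
  ∀ (a : ι) (I : ι → Fin n),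
    ∑ p ∈ univ.erase a, f (I ∘ Equiv.swap a p) = (1 - n : ℝ) * f I

def Sgn (f : (ι → Fin n) → ℝ) : Prop :=
  ∀ (i : Fin n) (I : ι → Fin n), (∏ p, (if I p = i then (-1 : ℝ) else 1)) * f I = f I

lemma inv_jm {f : (ι → Fin n) → ℝ} (hf : Inv f)
    (ht : ∀ a b, a ≠ b → ∀ I : ι → Fin n, ∑ j, f (update (update I a j) b j) = 0) : JM f := by
  intro a I
  have h : ∑ j, ∑ p, (if update I a j p = I a then f (update (update I a j) p j) else 0) =
      ∑ j, ∑ p, (if update I a j p = j then f (update (update I a j) p (I a)) else 0) :=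
    Finset.sum_congr rfl fun j _ => inv_lie hf (I a) j (update I a j)
  rw [Finset.sum_comm, Finset.sum_comm (s := univ (α := Fin n)) (t := univ (α := ι))
    (f := fun j p => (if update I a j p = j then f (update (update I a j) p (I a)) else 0))] at h
  rw [← Finset.add_sum_erase _ _ (Finset.mem_univ a),
    ← Finset.add_sum_erase _ _ (Finset.mem_univ a)] at h
  have e1 : ∑ j, (if update I a j a = I a then f (update (update I a j) a j) else 0) = f I := by
    simp
  have e2 : ∑ j, (if update I a j a = j then f (update (update I a j) a (I a)) else 0) =
      n * f I := by
    simp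
  have e3 : ∑ p ∈ univ.erase a, ∑ j,
      (if update I a j p = I a then f (update (update I a j) p j) else 0) = 0 := by
    refine Finset.sum_eq_zero fun p hp => ?_
    have hpa : p ≠ a := (Finset.mem_erase.1 hp).1
    by_cases hI : I p = I a
    · simpa [hpa, hI] using ht a p hpa.symm I
    · simp [hpa, hI]
  have e4 : ∑ p ∈ univ.erase a, ∑ j,
      (if update I a j p = j then f (update (update I a j) p (I a)) else 0) =
      ∑ p ∈ univ.erase a, f (I ∘ Equiv.swap a p) := by
    refine Finset.sum_congr rfl fun p hp => ?_
    have hpa : p ≠ a := (Finset.mem_erase.1 hp).1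
    simp only [update_of_ne hpa]
    rw [Finset.sum_ite_eq]
    simp only [Finset.mem_univ, if_true]
    congr 1
    funext q
    by_cases hq : q = p
    · subst hq; simp
    · by_cases hqa : q = a
      · subst hqa; simp [hq]
      · simp [hq, hqa, Equiv.swap_apply_of_ne_of_ne hqa hq]
  rw [e1, e2, e3, e4] at h
  linarith

lemma jm_perm {f : (ι → Fin n) → ℝ} (hf : JM f) (σ : Equiv.Perm ι) :
    JM (fun I => f (I ∘ σ)) := by
  intro a I
  have h := hf (σ.symm a) (I ∘ σ)
  simp only
  rw [← h]
  symm
  refine Finset.sum_bij (fun p _ => σ p) ?_ ?_ ?_ ?_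
  · intro p hp
    simp only [Finset.mem_erase, Finset.mem_univ, and_true] at hp ⊢
    rintro rfl; simp at hp
  · intro p _ q _ h; exact σ.injective h
  · intro p hp
    refine ⟨σ.symm p, ?_, by simp⟩
    simpa using hp
  · intro p hp
    congr 1
    funext q
    simp only [comp_apply]
    congr 1
    rw [← Equiv.apply_symm_apply σ a, Equiv.symm_apply_apply σ]
    exact σ.injective.map_swap _ _ _

lemma sgn_perm {f : (ι → Fin n) → ℝ} (hf : Sgn f) (σ : Equiv.Perm ι) :
    Sgn (fun I => f (I ∘ σ)) := by
  intro i I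
  have h := hf i (I ∘ σ)
  simp only [comp_apply] at h
  rwa [Equiv.prod_comp σ (fun p => if I p = i then (-1 : ℝ) else 1)] at h

def Alt (S : Finset ι) (f : (ι → Fin n) → ℝ) : Prop :=
  ∀ a ∈ S, ∀ b ∈ S, a ≠ b → ∀ I, f (I ∘ Equiv.swap a b) = - f I

lemma alt_insert {f : (ι → Fin n) → ℝ} {S : Finset ι} (hf : Alt S f) {b : ι} (hb : b ∉ S) :
    Alt (insert b S) (fun I => f I - ∑ a ∈ S, f (I ∘ Equiv.swap a b)) := by
  have hB : ∀ c ∈ S, ∀ I, f (I ∘ Equiv.swap c b) -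
      ∑ a ∈ S, f ((I ∘ Equiv.swap c b) ∘ Equiv.swap a b) =
      - (f I - ∑ a ∈ S, f (I ∘ Equiv.swap a b)) := by
    intro c hc I
    have hcb : c ≠ b := by rintro rfl; exact hb hc
    rw [← Finset.add_sum_erase _ _ hc, ← Finset.add_sum_erase S _ hc]
    have e1 : (I ∘ Equiv.swap c b) ∘ Equiv.swap c b = I := by
      funext q; simp
    have e2 : ∑ a ∈ S.erase c, f ((I ∘ Equiv.swap c b) ∘ Equiv.swap a b) =
        ∑ a ∈ S.erase c, - f (I ∘ Equiv.swap a b) := by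
      refine Finset.sum_congr rfl fun a ha => ?_
      obtain ⟨hac, haS⟩ := Finset.mem_erase.1 ha
      have hab : a ≠ b := by rintro rfl; exact hb haS
      rw [← hf a haS c hc hac]
      congr 1
      funext q
      simp only [comp_apply]
      congr 1
      simp only [Equiv.swap_apply_def]
      split_ifs <;> simp_all
    rw [e1, e2, Finset.sum_neg_distrib]
    ring
  intro c hc d hd hcd I
  rw [Finset.mem_insert] at hc hd
  rcases hc with rfl | hc
  · rcases hd with rfl | hd
    · exact absurd rfl hcd
    · simp only [Equiv.swap_comm c d]
      exact hB d hd I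
  · rcases hd with rfl | hd
    · exact hB c hc I
    · simp only
      rw [hf c hc d hd hcd]
      have e : ∑ a ∈ S, f ((I ∘ Equiv.swap c d) ∘ Equiv.swap a b) =
          ∑ a ∈ S, - f (I ∘ Equiv.swap a b) := by
        refine Finset.sum_bij (fun a _ => Equiv.swap c d a) ?_ ?_ ?_ ?_
        · intro a ha
          simp only [Equiv.swap_apply_def]
          split_ifs <;> assumption
        · intro x _ y _ h; exact (Equiv.swap c d).injective h
        · intro x hx
          refine ⟨Equiv.swap c d x, ?_, by simp⟩
          simp only [Equiv.swap_apply_def]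
          split_ifs <;> assumption
        · intro a ha
          rw [← hf c hc d hd hcd]
          congr 1
          funext q
          simp only [comp_apply]
          congr 1
          have hbb : Equiv.swap c d b = b := by
            apply Equiv.swap_apply_of_ne_of_ne
            · rintro rfl; exact hb hc
            · rintro rfl; exact hb hd
          have := (Equiv.swap c d).injective.map_swap (x := a) (y := b) (z := q)
          rw [this, hbb]
      rw [e, Finset.sum_neg_distrib]
      ring

lemma alt_zero {f : (ι → Fin n) → ℝ} {S : Finset ι} (hf : Alt S f) {I : ι → Fin n}
    (hI : f I ≠ 0) : Set.InjOn I S := by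
  intro a ha b hb hab
  by_contra hne
  have h := hf a ha b hb hne I
  have : I ∘ Equiv.swap a b = I := by
    funext q
    simp only [comp_apply, Equiv.swap_apply_def]
    split_ifs <;> simp_all
  rw [this] at h
  apply hI
  linarith

lemma core_zero [Nonempty ι] {f : (ι → Fin n) → ℝ} (hj : JM f) (hs : Sgn f) : f = 0 := by
  classical
  by_contra hne
  let Q : ℕ → Prop := fun r => ∃ (S : Finset ι) (g : (ι → Fin n) → ℝ),
    S.card = r ∧ g ≠ 0 ∧ JM g ∧ Sgn g ∧ Alt S g
  have hQ1 : Q 1 := by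
    obtain ⟨a⟩ := ‹Nonempty ι›
    refine ⟨{a}, f, by simp, hne, hj, hs, ?_⟩
    intro x hx y hy hxy
    simp only [Finset.mem_singleton] at hx hy
    exact absurd (hx.trans hy.symm) hxy
  have hbd : ∀ r, Q r → r ≤ Fintype.card ι := by
    rintro r ⟨S, g, rfl, -⟩; exact Finset.card_le_univ S
  obtain ⟨r, hr, hmax, h1r⟩ : ∃ r, Q r ∧ ¬ Q (r + 1) ∧ 1 ≤ r := by
    let r := Nat.findGreatest Q (Fintype.card ι)
    have hr : Q r := Nat.findGreatest_spec (hbd 1 hQ1) hQ1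
    refine ⟨r, hr, ?_, Nat.le_findGreatest (hbd 1 hQ1) hQ1⟩
    intro h
    have : r + 1 ≤ r := Nat.le_findGreatest (hbd _ h) h
    omega
  obtain ⟨S, g, hS, hg, hgj, hgs, hga⟩ := hr
  have hb : ∀ b ∉ S, ∀ I, ∑ a ∈ S, g (I ∘ Equiv.swap a b) = g I := by
    intro b hb
    by_contra hc
    apply hmax
    refine ⟨insert b S, fun I => g I - ∑ a ∈ S, g (I ∘ Equiv.swap a b), ?_, ?_, ?_, ?_,
      alt_insert hga hb⟩
    · rw [Finset.card_insert_of_notMem hb, hS]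
    · intro h
      apply hc
      intro I
      have := congrFun h I
      simp only [Pi.zero_apply] at this
      linarith
    · intro a I
      simp only
      rw [Finset.sum_sub_distrib, hgj a I, Finset.sum_comm, mul_sub, Finset.mul_sum]
      congr 1
      refine Finset.sum_congr rfl fun c _ => ?_
      exact jm_perm hgj (Equiv.swap c b) a I
    · intro i I
      simp only
      rw [mul_sub, hgs i I, Finset.mul_sum]
      congr 1
      refine Finset.sum_congr rfl fun c _ => ?_
      exact sgn_perm hgs (Equiv.swap c b) i I
  obtain ⟨I, hI⟩ := Function.ne_iff.1 hg
  simp only [Pi.zero_apply] at hI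
  have hinj := alt_zero hga hI
  have hrn : r ≤ n := by
    have := Finset.card_image_of_injOn hinj
    rw [← hS, ← this]
    simpa using Finset.card_le_univ (S.image I)
  have hsum : ∑ a ∈ S, ∑ p ∈ univ.erase a, g (I ∘ Equiv.swap a p) =
      r * ((1 - n : ℝ) * g I) := by
    rw [Finset.sum_congr rfl fun a _ => hgj a I]
    simp [hS]
  have hsplit : ∀ a ∈ S, ∑ p ∈ univ.erase a, g (I ∘ Equiv.swap a p) =
      -((r : ℝ) - 1) * g I + ∑ p ∈ Sᶜ, g (I ∘ Equiv.swap a p) := by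
    intro a ha
    have hd : Disjoint (S.erase a) Sᶜ := by
      refine Finset.disjoint_left.2 fun x hx hx' => ?_
      exact (Finset.mem_compl.1 hx') (Finset.mem_of_mem_erase hx)
    have : univ.erase a = S.erase a ∪ Sᶜ := by
      ext x
      simp only [Finset.mem_erase, Finset.mem_univ, and_true, Finset.mem_union, Finset.mem_compl]
      constructor
      · intro h; by_cases hx : x ∈ S <;> tauto
      · rintro (h | h)
        · exact h.1
        · rintro rfl; exact h ha
    rw [this, Finset.sum_union hd]
    congr 1
    rw [Finset.sum_congr rfl fun p hp => hga a ha p (Finset.mem_of_mem_erase hp)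
      (Ne.symm (Finset.ne_of_mem_erase hp)) I]
    rw [Finset.sum_const, Finset.card_erase_of_mem ha, hS, nsmul_eq_mul, Nat.cast_sub h1r]
    push_cast; ring
  rw [Finset.sum_congr rfl hsplit, Finset.sum_add_distrib, Finset.sum_comm,
    Finset.sum_congr rfl (fun b hbS => hb b (Finset.mem_compl.1 hbS) I)] at hsum
  simp only [Finset.sum_const, hS, nsmul_eq_mul] at hsum
  have hk : (r : ℝ) * (-((r : ℝ) - 1)) + (Sᶜ.card : ℝ) = r * (1 - n) := by
    apply mul_right_cancel₀ hI
    linarith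
  have hrn' : (r : ℝ) ≤ n := by exact_mod_cast hrn
  have h1r' : (1 : ℝ) ≤ r := by exact_mod_cast h1r
  have hc0 : (0 : ℝ) ≤ (Sᶜ.card : ℝ) := Nat.cast_nonneg _
  have hreq : (r : ℝ) = n := by
    apply le_antisymm hrn'
    by_contra hlt
    push Not at hlt
    nlinarith
  have hcz : (Sᶜ.card : ℝ) = 0 := by
    rw [← hreq] at hk; linarith
  have hSu : S = univ := by
    have : Sᶜ.card = 0 := by exact_mod_cast hcz
    rw [Finset.card_eq_zero] at this
    simpa using this
  have hrn2 : r = n := by exact_mod_cast hreq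
  subst hSu
  have hinj' : Function.Injective I := fun x y h => hinj (by simp) (by simp) h
  have hcard : Fintype.card ι = Fintype.card (Fin n) := by
    rw [Fintype.card_fin, ← hrn2, ← hS]; rfl
  have hbij : Function.Bijective I := (Fintype.bijective_iff_injective_and_card I).2 ⟨hinj', hcard⟩
  obtain ⟨q⟩ := ‹Nonempty ι›
  have h := hgs (I q) I
  rw [Finset.prod_eq_single q] at h
  · simp at h
    apply hI; linarith
  · intro b _ hbq
    rw [if_neg]
    intro h; exact hbq (hinj' h)
  · simp

end core

section span

set_option linter.unusedSectionVars false

variable {n : ℕ}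

/-- Product form of a complete pairing. -/
def pairFun {n l : ℕ} {ι : Type} (u : Fin l × Fin 2 → ι) : (ι → Fin n) → ℝ :=
  fun I => ∏ m, (1 : Matrix (Fin n) (Fin n) ℝ) (I (u (m, 0))) (I (u (m, 1)))

lemma sum_prod_pair {l : ℕ} {ι : Type} [Fintype ι] (e : Fin l × Fin 2 ≃ ι)
    (A : Matrix (Fin n) (Fin n) ℝ) (I : ι → Fin n) :
    ∑ j : Fin l → Fin n, ∏ p, A (I p) (j (e.symm p).1) =
      ∏ m, (A * A.transpose) (I (e (m, 0))) (I (e (m, 1))) := by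
  simp_rw [Matrix.mul_apply, Matrix.transpose_apply]
  rw [Finset.prod_univ_sum]
  simp only [Fintype.piFinset_univ]
  refine Finset.sum_congr rfl fun j _ => ?_
  rw [← Equiv.prod_comp e, Fintype.prod_prod_type]
  simp [Fin.prod_univ_two]

lemma pairFun_eq {l : ℕ} {ι : Type} [Fintype ι] (e : Fin l × Fin 2 ≃ ι) (I : ι → Fin n) :
    pairFun e I = ∑ j : Fin l → Fin n, ∏ p,
      (1 : Matrix (Fin n) (Fin n) ℝ) (I p) (j (e.symm p).1) := by
  rw [sum_prod_pair]; simp [pairFun]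

lemma prod_one {ι : Type} [Fintype ι] [DecidableEq ι] (I J : ι → Fin n) :
    ∏ p, (1 : Matrix (Fin n) (Fin n) ℝ) (I p) (J p) = if I = J then 1 else 0 := by
  split_ifs with h
  · subst h; simp
  · obtain ⟨p, hp⟩ := Function.ne_iff.1 h
    exact Finset.prod_eq_zero (Finset.mem_univ p) (Matrix.one_apply_ne hp)

lemma pairFun_inv {l : ℕ} {ι : Type} [Fintype ι] [DecidableEq ι] (e : Fin l × Fin 2 ≃ ι) :
    Inv (pairFun (n := n) e) := by
  intro A hA
  funext I
  have hA' : A * A.transpose = 1 := (Matrix.mem_orthogonalGroup_iff _ _).1 hA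
  rw [show pairFun e I = ∑ j : Fin l → Fin n, ∏ p, A (I p) (j (e.symm p).1) by
    rw [sum_prod_pair, hA']; rfl]
  unfold act
  simp_rw [pairFun_eq, prod_one, Finset.mul_sum]
  rw [Finset.sum_comm]
  refine Finset.sum_congr rfl fun j _ => ?_
  simp

lemma act_add {ι : Type} [Fintype ι] [DecidableEq ι] (A : Matrix (Fin n) (Fin n) ℝ)
    (f g : (ι → Fin n) → ℝ) : act A (f + g) = act A f + act A g := by
  funext I; simp [act, mul_add, Finset.sum_add_distrib]

lemma act_smul {ι : Type} [Fintype ι] [DecidableEq ι] (A : Matrix (Fin n) (Fin n) ℝ)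
    (c : ℝ) (g : (ι → Fin n) → ℝ) : act A (c • g) = c • act A g := by
  funext I; simp only [act, Pi.smul_apply, smul_eq_mul, Finset.mul_sum]
  exact Finset.sum_congr rfl fun _ _ => by ring

def W (n l k : ℕ) : Submodule ℝ ((Fin k → Fin n) → ℝ) :=
  Submodule.span ℝ (Set.range fun e : Fin l × Fin 2 ≃ Fin k => pairFun (n := n) e)

lemma W_inv {l k : ℕ} {f : (Fin k → Fin n) → ℝ} (hf : f ∈ W n l k) : Inv f := by
  intro A hA
  unfold W at hf
  induction hf using Submodule.span_induction with
  | mem x hx => obtain ⟨e, rfl⟩ := hx; exact pairFun_inv e A hA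
  | zero => funext I; simp [act]
  | add x y _ _ hx hy => rw [act_add, hx, hy]
  | smul c x _ hx => rw [act_smul, hx]

lemma exists_orth {X : Type} [Fintype X] (U : Submodule ℝ (X → ℝ)) (f : X → ℝ) :
    ∃ w ∈ U, ∀ v ∈ U, ∑ x, (f - w) x * v x = 0 := by
  let L : EuclideanSpace ℝ X ≃ₗ[ℝ] (X → ℝ) := WithLp.linearEquiv 2 ℝ (X → ℝ)
  obtain ⟨y, hy, z, hz, h⟩ := (U.comap L.toLinearMap).exists_add_mem_mem_orthogonal (L.symm f)
  refine ⟨L y, hy, fun v hv => ?_⟩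
  have hz' := (Submodule.mem_orthogonal _ _).1 hz (L.symm v) (by simpa using hv)
  have e : f - L y = L z := by
    have : f = L (L.symm f) := by simp
    rw [this, h]; simp
  rw [e]
  rw [PiLp.inner_apply] at hz'
  simpa [L] using hz'

lemma sum_cons2 {k : ℕ} (F : (Fin (k + 2) → Fin n) → ℝ) :
    ∑ I, F I = ∑ K : Fin k → Fin n, ∑ x, ∑ y, F (Fin.cons x (Fin.cons y K : Fin (k + 1) → Fin n)) := by
  have h1 : ∀ {m : ℕ} (G : (Fin (m + 1) → Fin n) → ℝ),
      ∑ I, G I = ∑ x, ∑ K : Fin m → Fin n, G (Fin.cons x K) := by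
    intro m G
    rw [← Equiv.sum_comp (Fin.consEquiv fun _ => Fin n), Fintype.sum_prod_type]
    rfl
  rw [h1, Finset.sum_comm]
  rw [h1 (fun K => ∑ x, F (Fin.cons x K)), Finset.sum_comm]
  exact Finset.sum_congr rfl fun K _ => Finset.sum_comm

/-- Contraction of the first two slots. -/
def contr {k : ℕ} (f : (Fin (k + 2) → Fin n) → ℝ) : (Fin k → Fin n) → ℝ :=
  fun K => ∑ j, f (Fin.cons j (Fin.cons j K : Fin (k + 1) → Fin n))

lemma contr_inv {k : ℕ} {f : (Fin (k + 2) → Fin n) → ℝ} (hf : Inv f) : Inv (contr f) := by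
  intro A hA
  funext K
  have hA' : A.transpose * A = 1 := (Matrix.mem_orthogonalGroup_iff' _ _).1 hA
  have h1 : contr f K = ∑ j, act A f (Fin.cons j (Fin.cons j K : Fin (k + 1) → Fin n)) := by
    rw [hf A hA]; rfl
  have h1' : ∀ j, act A f (Fin.cons j (Fin.cons j K : Fin (k + 1) → Fin n)) =
      ∑ K_2 : Fin k → Fin n, ∑ x, ∑ y, A j x * (A j y * ∏ p, A (K p) (K_2 p)) *
        f (Fin.cons x (Fin.cons y K_2 : Fin (k + 1) → Fin n)) := by
    intro j
    unfold act
    rw [sum_cons2]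
    refine Finset.sum_congr rfl fun K_2 _ => Finset.sum_congr rfl fun x _ =>
      Finset.sum_congr rfl fun y _ => ?_
    rw [Fin.prod_univ_succ, Fin.prod_univ_succ]
    rfl
  rw [h1, Finset.sum_congr rfl fun j _ => h1' j]
  unfold act contr
  symm
  rw [Finset.sum_comm]
  refine Finset.sum_congr rfl fun K_2 _ => ?_
  have h2 : ∀ x y, ∑ j, A j x * A j y = if x = y then 1 else 0 := by
    intro x y
    have := congrFun (congrFun hA' x) y
    rw [Matrix.mul_apply, Matrix.one_apply] at this
    simpa using this
  rw [Finset.mul_sum, Finset.sum_comm]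
  refine Finset.sum_congr rfl fun x _ => ?_
  rw [Finset.sum_comm]
  have h3 : ∀ y, ∑ j, A j x * (A j y * ∏ p, A (K p) (K_2 p)) *
      f (Fin.cons x (Fin.cons y K_2 : Fin (k + 1) → Fin n)) =
      (if x = y then 1 else 0) * ((∏ p, A (K p) (K_2 p)) *
        f (Fin.cons x (Fin.cons y K_2 : Fin (k + 1) → Fin n))) := by
    intro y
    rw [← h2, Finset.sum_mul]
    exact Finset.sum_congr rfl fun _ _ => by ring
  simp_rw [h3]
  simp

/-- Insert a pairing of `σ 0` and `σ 1`. -/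
def ins {k : ℕ} (σ : Equiv.Perm (Fin (k + 2))) :
    ((Fin k → Fin n) → ℝ) →ₗ[ℝ] ((Fin (k + 2) → Fin n) → ℝ) where
  toFun c := fun I => (1 : Matrix (Fin n) (Fin n) ℝ) (I (σ 0)) (I (σ 1)) *
    c (fun p => I (σ p.succ.succ))
  map_add' c d := by funext I; simp [mul_add]
  map_smul' r d := by funext I; simp; ring

lemma ins_mem {l k : ℕ} (σ : Equiv.Perm (Fin (k + 2))) {c : (Fin k → Fin n) → ℝ}
    (hc : c ∈ W n l k) : ins σ c ∈ W n (l + 1) (k + 2) := by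
  unfold W at hc
  induction hc using Submodule.span_induction with
  | mem x hx =>
    obtain ⟨e, rfl⟩ := hx
    apply Submodule.subset_span
    let u : Fin (l + 1) × Fin 2 → Fin (k + 2) := fun q =>
      σ (Fin.cases (motive := fun _ => Fin (k + 2)) (if q.2 = 0 then 0 else 1)
        (fun m => (e (m, q.2)).succ.succ) q.1)
    have hu : Function.Injective u := by
      rintro ⟨m, s⟩ ⟨m_2, s_2⟩ h
      have h := σ.injective h
      cases m using Fin.cases with
      | zero =>
        cases m_2 using Fin.cases with
        | zero => 
          fin_cases s <;> fin_cases s_2 <;> simp_all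
        | succ m_2 =>
          exfalso
          fin_cases s 
          · have h' : (0 : Fin (k + 2)) = (e (m_2, s_2)).succ.succ := h
            exact (Fin.succ_ne_zero _ h'.symm)
          · have h' : (1 : Fin (k + 2)) = (e (m_2, s_2)).succ.succ := h
            rw [← Fin.succ_zero_eq_one] at h'
            exact Fin.succ_ne_zero _ (Fin.succ_injective _ h').symm
      | succ m =>
        cases m_2 using Fin.cases with
        | zero => 
          exfalso
          fin_cases s_2
          · have h' : (e (m, s)).succ.succ = (0 : Fin (k + 2)) := h
            exact (Fin.succ_ne_zero _ h')
          · have h' : (e (m, s)).succ.succ = (1 : Fin (k + 2)) := h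
            rw [← Fin.succ_zero_eq_one] at h'
            exact Fin.succ_ne_zero _ (Fin.succ_injective _ h')
        | succ m_2 =>
          have h' : (e (m, s)).succ.succ = (e (m_2, s_2)).succ.succ := h
          have := e.injective (Fin.succ_injective _ (Fin.succ_injective _ h'))
          simp_all
    have hcard : Fintype.card (Fin (l + 1) × Fin 2) = Fintype.card (Fin (k + 2)) := by
      have := Fintype.card_congr e
      simp at this ⊢
      omega
    refine ⟨Equiv.ofBijective u ((Fintype.bijective_iff_injective_and_card u).2 ⟨hu, hcard⟩), ?_⟩
    funext I
    simp only [pairFun, Equiv.ofBijective_apply]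
    rw [Fin.prod_univ_succ]
    rfl
  | zero => simp
  | add x y _ _ hx hy => rw [map_add]; exact Submodule.add_mem _ hx hy
  | smul c x _ hx => rw [map_smul]; exact Submodule.smul_mem _ _ hx

lemma ins_pair {k : ℕ} (σ : Equiv.Perm (Fin (k + 2))) (h : (Fin (k + 2) → Fin n) → ℝ)
    (c : (Fin k → Fin n) → ℝ) :
    ∑ I, h I * ins σ c I = ∑ K, contr (fun I => h (I ∘ σ.symm)) K * c K := by
  rw [← Equiv.sum_comp (Equiv.arrowCongr σ (Equiv.refl (Fin n))), sum_cons2]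
  refine Finset.sum_congr rfl fun K _ => ?_
  unfold contr
  rw [Finset.sum_mul]
  refine Finset.sum_congr rfl fun x _ => ?_
  have key : ∀ y, ins σ c ((Equiv.arrowCongr σ (Equiv.refl (Fin n)))
      (Fin.cons x (Fin.cons y K : Fin (k + 1) → Fin n))) =
      (1 : Matrix (Fin n) (Fin n) ℝ) x y * c K := by
    intro y
    change (1 : Matrix (Fin n) (Fin n) ℝ)
      ((Fin.cons x (Fin.cons y K : Fin (k + 1) → Fin n) : Fin (k + 2) → Fin n) (σ.symm (σ 0)))
      ((Fin.cons x (Fin.cons y K : Fin (k + 1) → Fin n) : Fin (k + 2) → Fin n) (σ.symm (σ 1))) *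
      c (fun p => (Fin.cons x (Fin.cons y K : Fin (k + 1) → Fin n) : Fin (k + 2) → Fin n)
        (σ.symm (σ p.succ.succ))) = _
    rw [σ.symm_apply_apply 0, σ.symm_apply_apply 1]
    simp only [Equiv.symm_apply_apply]
    rfl
  simp_rw [key]
  rw [Finset.sum_eq_single x]
  · rw [Matrix.one_apply_eq, one_mul]; rfl
  · intro y _ hy
    rw [Matrix.one_apply_ne (Ne.symm hy)]; simp
  · simp

lemma exists_perm {k : ℕ} {a b : Fin (k + 2)} (hab : a ≠ b) :
    ∃ σ : Equiv.Perm (Fin (k + 2)), σ 0 = a ∧ σ 1 = b := by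
  have h01 : (0 : Fin (k + 2)) ≠ 1 := by simp
  have hb : Equiv.swap 0 a b ≠ 0 := by
    intro h
    have := congrArg (Equiv.swap 0 a) h
    simp at this
    exact hab this.symm
  refine ⟨Equiv.swap 0 a * Equiv.swap 1 (Equiv.swap 0 a b), ?_, ?_⟩
  · rw [Equiv.Perm.mul_apply, Equiv.swap_apply_of_ne_of_ne h01 hb.symm, Equiv.swap_apply_left]
  · rw [Equiv.Perm.mul_apply, Equiv.swap_apply_left, Equiv.swap_apply_self]

theorem inv_mem_W (l : ℕ) : ∀ {f : (Fin (2 * l) → Fin n) → ℝ}, Inv f → f ∈ W n l (2 * l) := by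
  induction l with
  | zero =>
    intro f _
    have : IsEmpty (Fin (2 * 0)) := inferInstanceAs (IsEmpty (Fin 0))
    have : f = f Fin.elim0 • pairFun (n := n) (Equiv.equivOfIsEmpty (Fin 0 × Fin 2) (Fin (2 * 0))) := by
      funext I
      have : I = Fin.elim0 := Subsingleton.elim _ _
      simp [pairFun, this]
    rw [this]
    exact Submodule.smul_mem _ _ (Submodule.subset_span ⟨_, rfl⟩)
  | succ l ih =>
    change ∀ {f : (Fin (2 * l + 2) → Fin n) → ℝ}, Inv f → f ∈ W n (l + 1) (2 * l + 2)
    intro f hf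
    obtain ⟨w, hw, horth⟩ := exists_orth (W n (l + 1) (2 * l + 2)) f
    have hinv : Inv (f - w) := by
      intro A hA
      have h1 := hf A hA
      have h2 := W_inv hw A hA
      have h3 : f - w = f + (-1 : ℝ) • w := by simp [sub_eq_add_neg]
      rw [h3, act_add, act_smul, h1, h2]
    have hz : f - w = 0 := by
      refine core_zero (inv_jm hinv ?_) (inv_sign hinv)
      intro a b hab I
      obtain ⟨σ, ha, hb⟩ := exists_perm hab
      let c := contr (fun I => (f - w) (I ∘ σ.symm))
      have hc : Inv c := contr_inv (inv_perm hinv σ.symm)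
      have h0 := horth _ (ins_mem σ (ih hc))
      rw [ins_pair] at h0
      have hcz : ∀ K, c K = 0 := by
        intro K
        have := (Finset.sum_eq_zero_iff_of_nonneg (fun K _ => mul_self_nonneg (c K))).1 h0 K
          (Finset.mem_univ K)
        exact mul_self_eq_zero.1 this
      rw [← hcz (fun p => I (σ p.succ.succ))]
      refine Finset.sum_congr rfl fun j _ => ?_
      change (f - w) _ = (f - w) _
      refine congrArg (f - w) ?_
      funext q
      obtain ⟨q, rfl⟩ := σ.surjective q
      simp only [comp_apply, Equiv.symm_apply_apply]
      subst ha hb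
      cases q using Fin.cases with
      | zero => simp
      | succ q =>
        cases q using Fin.cases with
        | zero => simp
        | succ q =>
          have e0 : q.succ.succ ≠ 0 := Fin.succ_ne_zero _
          have e1 : q.succ.succ ≠ 1 := by
            rw [← Fin.succ_zero_eq_one]
            exact fun h => Fin.succ_ne_zero _ (Fin.succ_injective _ h)
          simp [e0, e1]
    have : f = w := sub_eq_zero.1 hz
    rw [this]; exact hw

end span

section transfer

variable {n k : ℕ}

noncomputable def bas (n k : ℕ) : Module.Basis (Fin k → Fin n) ℝ (TPow n k) :=
  Basis.piTensorProduct (fun _ => Pi.basisFun ℝ (Fin n))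

lemma bas_tprod (v : Fin k → Fin n → ℝ) (I : Fin k → Fin n) :
    (bas n k).equivFun (PiTensorProduct.tprod ℝ v) I = ∏ p, v p (I p) := by
  rw [Module.Basis.equivFun_apply, bas, Basis.piTensorProduct_repr_tprod_apply]
  simp

lemma bas_tact (A : Matrix (Fin n) (Fin n) ℝ) (ξ : TPow n k) :
    (bas n k).equivFun (tact A ξ) = act A ((bas n k).equivFun ξ) := by
  induction ξ using PiTensorProduct.induction_on with
  | smul_tprod r v =>
    rw [map_smul, map_smul, map_smul, act_smul]
    congr 1
    funext I
    rw [tact, PiTensorProduct.map_tprod, bas_tprod]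
    unfold act
    simp_rw [bas_tprod, Matrix.mulVecLin_apply, Matrix.mulVec, dotProduct]
    rw [Finset.prod_univ_sum]
    simp [Finset.prod_mul_distrib]
  | add x y hx hy => rw [map_add, map_add, map_add, act_add, hx, hy]

/-- standard identification -/
def std (l : ℕ) : Fin l × Fin 2 ≃ Fin (2 * l) :=
  finProdFinEquiv.trans (finCongr (Nat.mul_comm l 2))

lemma bas_pair (l : ℕ) (σ : Equiv.Perm (Fin (2 * l))) :
    (bas n (2 * l)).equivFun (pairTensor n l σ) = pairFun ((std l).trans σ) := by
  funext I
  rw [pairFun_eq, pairTensor, map_sum, Finset.sum_apply]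
  refine Finset.sum_congr rfl fun j _ => ?_
  rw [bas_tprod]
  refine Finset.prod_congr rfl fun p _ => ?_
  rw [Pi.single_apply, Matrix.one_apply]
  rfl

end transfer

end FFT

/-- First fundamental theorem of invariant theory for `O(n)` on even tensor powers:
the subspace of `O(n)`-invariant elements of `⊗^{2l} ℝⁿ` is spanned by the complete
pairing tensors. -/
theorem invariant_iff_mem_span_pairTensor {n l : ℕ} (ξ : TPow n (2 * l)) :
    (∀ A ∈ Matrix.orthogonalGroup (Fin n) ℝ, tact A ξ = ξ) ↔
      ξ ∈ Submodule.span ℝ (Set.range (pairTensor n l)) := by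
  have h1 : (∀ A ∈ Matrix.orthogonalGroup (Fin n) ℝ, tact A ξ = ξ) ↔
      FFT.Inv ((FFT.bas n (2 * l)).equivFun ξ) := by
    refine forall_congr' fun A => forall_congr' fun _ => ?_
    rw [← FFT.bas_tact]
    exact (FFT.bas n (2 * l)).equivFun.injective.eq_iff.symm
  have h2 : (Submodule.span ℝ (Set.range (pairTensor n l))).map
      (FFT.bas n (2 * l)).equivFun.toLinearMap = FFT.W n l (2 * l) := by
    rw [Submodule.map_span, FFT.W, ← Set.range_comp]
    congr 1
    ext x
    constructor
    · rintro ⟨σ, rfl⟩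
      exact ⟨(FFT.std l).trans σ, (FFT.bas_pair l σ).symm⟩
    · rintro ⟨e, rfl⟩
      refine ⟨(FFT.std l).symm.trans e, ?_⟩
      refine (FFT.bas_pair l _).trans ?_
      rw [← Equiv.trans_assoc, Equiv.self_trans_symm, Equiv.refl_trans]
  rw [h1]
  have h3 : FFT.Inv ((FFT.bas n (2 * l)).equivFun ξ) ↔
      (FFT.bas n (2 * l)).equivFun ξ ∈ FFT.W n l (2 * l) :=
    ⟨FFT.inv_mem_W l, FFT.W_inv⟩
  rw [h3, ← h2]
  constructor
  · rintro ⟨y, hy, h⟩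
    rw [← (FFT.bas n (2 * l)).equivFun.injective h]
    exact hy
  · exact fun h => ⟨ξ, h, rfl⟩
end

section
/- The space of O(n)-invariant elements of ⊗^4 ℝ^n (under the diagonal action) is spanned by the three tensors ξ₁ = Σ_{i,j} e_i⊗e_i⊗e_j⊗e_j, ξ₂ = Σ_{i,j} e_i⊗e_j⊗e_i⊗e_j, ξ₃ = Σ_{i,j} e_i⊗e_j⊗e_j⊗e_i, where (e_i) is the standard basis. -/
open scoped TensorProduct

/-- The standard basis vector `e_i` of `ℝⁿ`. -/
def e {n : ℕ} (i : Fin n) : Fin n → ℝ := Pi.single i 1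

/-- `ξ₁ = Σ_{i,j} e_i ⊗ e_i ⊗ e_j ⊗ e_j`. -/
noncomputable def xi1 (n : ℕ) : TPow n 4 :=
  ∑ i : Fin n, ∑ j : Fin n, PiTensorProduct.tprod ℝ ![e i, e i, e j, e j]

/-- `ξ₂ = Σ_{i,j} e_i ⊗ e_j ⊗ e_i ⊗ e_j`. -/
noncomputable def xi2 (n : ℕ) : TPow n 4 :=
  ∑ i : Fin n, ∑ j : Fin n, PiTensorProduct.tprod ℝ ![e i, e j, e i, e j]

/-- `ξ₃ = Σ_{i,j} e_i ⊗ e_j ⊗ e_j ⊗ e_i`. -/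
noncomputable def xi3 (n : ℕ) : TPow n 4 :=
  ∑ i : Fin n, ∑ j : Fin n, PiTensorProduct.tprod ℝ ![e i, e j, e j, e i]

/-- Pairing of a 4-tensor with `a ⊗ b ⊗ c ⊗ d`, linear in the tensor. -/
noncomputable def pairing {n : ℕ} (a b c d : Fin n → ℝ) : TPow n 4 →ₗ[ℝ] ℝ :=
  PiTensorProduct.lift ((MultilinearMap.mkPiAlgebra ℝ (Fin 4) ℝ).compLinearMap
    (fun i => dotProductBilin ℝ ℝ (![a, b, c, d] i)))

theorem pairing_tprod {n : ℕ} (a b c d : Fin n → ℝ) (w : Fin 4 → Fin n → ℝ) :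
    pairing a b c d (PiTensorProduct.tprod ℝ w) =
      (a ⬝ᵥ w 0) * (b ⬝ᵥ w 1) * (c ⬝ᵥ w 2) * (d ⬝ᵥ w 3) := by
  simp [pairing, Fin.prod_univ_four, dotProductBilin]

theorem pairing_hom1 {n : ℕ} (r s : ℝ) (a a' b c d : Fin n → ℝ) (ξ : TPow n 4) :
    pairing (r • a + s • a') b c d ξ = r * pairing a b c d ξ + s * pairing a' b c d ξ := by
  have : pairing (r • a + s • a') b c d = r • pairing a b c d + s • pairing a' b c d := by
    ext w
    simp [pairing_tprod]
    ring
  simp [this]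

theorem pairing_hom2 {n : ℕ} (r s : ℝ) (a b b' c d : Fin n → ℝ) (ξ : TPow n 4) :
    pairing a (r • b + s • b') c d ξ = r * pairing a b c d ξ + s * pairing a b' c d ξ := by
  have : pairing a (r • b + s • b') c d = r • pairing a b c d + s • pairing a b' c d := by
    ext w
    simp [pairing_tprod]
    ring
  simp [this]

theorem pairing_hom3 {n : ℕ} (r s : ℝ) (a b c c' d : Fin n → ℝ) (ξ : TPow n 4) :
    pairing a b (r • c + s • c') d ξ = r * pairing a b c d ξ + s * pairing a b c' d ξ := by
  have : pairing a b (r • c + s • c') d = r • pairing a b c d + s • pairing a b c' d := by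
    ext w
    simp [pairing_tprod]
    ring
  simp [this]

theorem pairing_hom4 {n : ℕ} (r s : ℝ) (a b c d d' : Fin n → ℝ) (ξ : TPow n 4) :
    pairing a b c (r • d + s • d') ξ = r * pairing a b c d ξ + s * pairing a b c d' ξ := by
  have : pairing a b c (r • d + s • d') = r • pairing a b c d + s • pairing a b c d' := by
    ext w
    simp [pairing_tprod]
    ring
  simp [this]

theorem pairing_tact {n : ℕ} (A : Matrix (Fin n) (Fin n) ℝ) (a b c d : Fin n → ℝ)
    (ξ : TPow n 4) :
    pairing a b c d (tact A ξ) =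
      pairing (A.transpose.mulVec a) (A.transpose.mulVec b) (A.transpose.mulVec c)
        (A.transpose.mulVec d) ξ := by
  have : pairing a b c d ∘ₗ tact A = pairing (A.transpose.mulVec a) (A.transpose.mulVec b)
      (A.transpose.mulVec c) (A.transpose.mulVec d) := by
    apply PiTensorProduct.ext
    refine MultilinearMap.ext fun w => ?_
    simp [pairing_tprod, tact, Matrix.mulVec_transpose, Matrix.dotProduct_mulVec]
  exact LinearMap.congr_fun this ξ

/-- The pairings with basis tensors determine the tensor. -/
theorem expand_tensor {n : ℕ} (ξ : TPow n 4) :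
    ξ = ∑ p : Fin 4 → Fin n, pairing (e (p 0)) (e (p 1)) (e (p 2)) (e (p 3)) ξ •
      PiTensorProduct.tprod ℝ (fun i => e (p i)) := by
  have : (LinearMap.id : TPow n 4 →ₗ[ℝ] TPow n 4) =
      ∑ p : Fin 4 → Fin n, (pairing (e (p 0)) (e (p 1)) (e (p 2)) (e (p 3))).smulRight
      (PiTensorProduct.tprod ℝ (fun i => (e (p i) : Fin n → ℝ))) := by
    apply PiTensorProduct.ext
    refine MultilinearMap.ext fun w => ?_
    simp only [LinearMap.compMultilinearMap_apply, LinearMap.id_coe, id, LinearMap.sum_apply,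
      LinearMap.smulRight_apply, pairing_tprod]
    have hw : w = fun i => ∑ j : Fin n, w i j • (e j : Fin n → ℝ) := by
      funext i k
      simp [e, Pi.single_apply]
    conv_lhs => rw [hw]
    rw [MultilinearMap.map_sum]
    refine Finset.sum_congr rfl fun p _ => ?_
    rw [MultilinearMap.map_smul_univ]
    simp [Fin.prod_univ_four, e]
  have h := LinearMap.congr_fun this ξ
  simpa using h

theorem ext_pairing {n : ℕ} {ξ η : TPow n 4}
    (h : ∀ i j k l, pairing (e i) (e j) (e k) (e l) ξ = pairing (e i) (e j) (e k) (e l) η) :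
    ξ = η := by
  rw [expand_tensor ξ, expand_tensor η]
  simp only [h]

theorem sum_e {n : ℕ} (a b : Fin n → ℝ) : ∑ i, (a ⬝ᵥ e i) * (b ⬝ᵥ e i) = a ⬝ᵥ b := by
  simp only [e, dotProduct_single_one]
  rfl

theorem pairing_xi1 {n : ℕ} (a b c d : Fin n → ℝ) :
    pairing a b c d (xi1 n) = (a ⬝ᵥ b) * (c ⬝ᵥ d) := by
  simp only [xi1, map_sum, pairing_tprod]
  rw [← sum_e a b, ← sum_e c d, Finset.sum_mul_sum]
  refine Finset.sum_congr rfl fun i _ => Finset.sum_congr rfl fun j _ => ?_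
  simp
  ring

theorem pairing_xi2 {n : ℕ} (a b c d : Fin n → ℝ) :
    pairing a b c d (xi2 n) = (a ⬝ᵥ c) * (b ⬝ᵥ d) := by
  simp only [xi2, map_sum, pairing_tprod]
  rw [← sum_e a c, ← sum_e b d, Finset.sum_mul_sum]
  refine Finset.sum_congr rfl fun i _ => Finset.sum_congr rfl fun j _ => ?_
  simp
  ring

theorem pairing_xi3 {n : ℕ} (a b c d : Fin n → ℝ) :
    pairing a b c d (xi3 n) = (a ⬝ᵥ d) * (b ⬝ᵥ c) := by
  simp only [xi3, map_sum, pairing_tprod]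
  rw [← sum_e a d, ← sum_e b c, Finset.sum_mul_sum]
  refine Finset.sum_congr rfl fun i _ => Finset.sum_congr rfl fun j _ => ?_
  simp
  ring

theorem orth_dot {n : ℕ} {A : Matrix (Fin n) (Fin n) ℝ}
    (hA : A ∈ Matrix.orthogonalGroup (Fin n) ℝ) (a b : Fin n → ℝ) :
    (A.transpose.mulVec a) ⬝ᵥ (A.transpose.mulVec b) = a ⬝ᵥ b := by
  have h := (Matrix.mem_orthogonalGroup_iff (Fin n) ℝ).1 hA
  rw [Matrix.dotProduct_mulVec, Matrix.vecMul_transpose, Matrix.mulVec_mulVec, h,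
    Matrix.one_mulVec]

/-- Householder reflection. -/
noncomputable def hhRefl {n : ℕ} (v : Fin n → ℝ) : Matrix (Fin n) (Fin n) ℝ :=
  1 - (2 / (v ⬝ᵥ v)) • Matrix.vecMulVec v v

theorem hhRefl_transpose {n : ℕ} (v : Fin n → ℝ) : (hhRefl v).transpose = hhRefl v := by
  simp [hhRefl, Matrix.transpose_vecMulVec]

theorem hhRefl_mem {n : ℕ} (v : Fin n → ℝ) (hv : v ⬝ᵥ v ≠ 0) :
    hhRefl v ∈ Matrix.orthogonalGroup (Fin n) ℝ := by
  rw [Matrix.mem_orthogonalGroup_iff, hhRefl_transpose]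
  simp only [hhRefl, sub_mul, mul_sub, one_mul, mul_one, smul_mul_smul_comm,
    Matrix.vecMulVec_mul_vecMulVec, Matrix.vecMulVec_smul, smul_smul]
  have : 2 / (v ⬝ᵥ v) * (2 / (v ⬝ᵥ v)) * (v ⬝ᵥ v) = 2 / (v ⬝ᵥ v) + 2 / (v ⬝ᵥ v) := by
    field_simp
    norm_num
  rw [this, add_smul]
  abel

theorem hhRefl_mulVec {n : ℕ} (v x : Fin n → ℝ) :
    (hhRefl v).mulVec x = x - (2 * (v ⬝ᵥ x) / (v ⬝ᵥ v)) • v := by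
  simp only [hhRefl, Matrix.sub_mulVec, Matrix.one_mulVec, Matrix.smul_mulVec,
    Matrix.vecMulVec_mulVec]
  ext i
  simp
  ring

theorem e_dot {n : ℕ} (i j : Fin n) : (e i : Fin n → ℝ) ⬝ᵥ e j = if i = j then 1 else 0 := by
  simp [e, Pi.single_apply, eq_comm]

theorem hhRefl_flip {n : ℕ} (k i : Fin n) :
    (hhRefl (e k)).mulVec (e i) = (if k = i then (-1 : ℝ) else 1) • e i + (0 : ℝ) • e i := by
  rw [hhRefl_mulVec, e_dot, e_dot]
  by_cases h : k = i
  · subst h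
    ext j
    simp
    ring
  · simp [h]

theorem hhRefl_swap {n : ℕ} (k l i : Fin n) (hkl : k ≠ l) :
    (hhRefl (e k - e l)).mulVec (e i) = e (Equiv.swap k l i) := by
  rw [hhRefl_mulVec]
  simp only [sub_dotProduct, dotProduct_sub, e_dot]
  by_cases h1 : i = k
  · subst h1
    ext j
    simp [hkl, hkl.symm]
    ring
  · by_cases h2 : i = l
    · subst h2
      ext j
      simp [hkl, hkl.symm]
      ring
    · simp [Equiv.swap_apply_of_ne_of_ne h1 h2, Ne.symm h1, Ne.symm h2]

theorem hhRefl_rot {n : ℕ} (k l : Fin n) (hkl : k ≠ l) :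
    (hhRefl (e k - (2 : ℝ) • e l)).mulVec (e k) = (3 / 5 : ℝ) • e k + (4 / 5 : ℝ) • e l := by
  rw [hhRefl_mulVec]
  simp only [sub_dotProduct, dotProduct_sub, smul_dotProduct, dotProduct_smul, e_dot]
  ext j
  simp [hkl, hkl.symm]
  ring

theorem coeffs {n : ℕ} (C : Fin n → Fin n → Fin n → Fin n → ℝ)
    (hflip : ∀ m i j k l, C i j k l =
      (if m = i then (-1 : ℝ) else 1) * (if m = j then (-1 : ℝ) else 1) *
      (if m = k then (-1 : ℝ) else 1) * (if m = l then (-1 : ℝ) else 1) * C i j k l)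
    (hswap : ∀ p q, p ≠ q → ∀ i j k l, C i j k l =
      C (Equiv.swap p q i) (Equiv.swap p q j) (Equiv.swap p q k) (Equiv.swap p q l))
    (hrot : ∀ k l, k ≠ l → C k k k k = C k k l l + C k l k l + C k l l k) :
    ∃ α β γ : ℝ, ∀ i j k l, C i j k l =
      α * ((if i = j then 1 else 0) * (if k = l then 1 else 0)) +
      β * ((if i = k then 1 else 0) * (if j = l then 1 else 0)) +
      γ * ((if i = l then 1 else 0) * (if j = k then 1 else 0)) := by
  by_cases hn : ∃ p q : Fin n, p ≠ q
  · obtain ⟨p, q, hpq⟩ := hn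
    have key : ∀ g : Fin n → Fin n → ℝ,
        (∀ a b, a ≠ b → ∀ i j, g i j = g (Equiv.swap a b i) (Equiv.swap a b j)) →
        ∀ i j, i ≠ j → g i j = g p q := by
      intro g hg i j hij
      have h1 : ∃ j', j' ≠ p ∧ g i j = g p j' := by
        by_cases hip : i = p
        · exact ⟨j, by rw [← hip]; exact hij.symm, by rw [hip]⟩
        · refine ⟨Equiv.swap i p j, ?_, ?_⟩
          · intro h
            apply hij
            apply (Equiv.swap i p).injective
            rw [h, Equiv.swap_apply_left]
          · rw [hg i p hip i j, Equiv.swap_apply_left]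
      obtain ⟨j', hj', h⟩ := h1
      rw [h]
      by_cases hjq : j' = q
      · rw [hjq]
      · rw [hg j' q hjq p j', Equiv.swap_apply_left,
          Equiv.swap_apply_of_ne_of_ne hj'.symm hpq]
    have k1 := key (fun i j => C i i j j) (fun a b hab i j => hswap a b hab _ _ _ _)
    have k2 := key (fun i j => C i j i j) (fun a b hab i j => hswap a b hab _ _ _ _)
    have k3 := key (fun i j => C i j j i) (fun a b hab i j => hswap a b hab _ _ _ _)
    have k4 : ∀ i, C i i i i = C p p q q + C p q p q + C p q q p := by
      intro i
      obtain ⟨j, hj⟩ : ∃ j, i ≠ j := by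
        by_cases h : i = p
        · exact ⟨q, by rw [h]; exact hpq⟩
        · exact ⟨p, h⟩
      rw [hrot i j hj]
      have := k1 i j hj
      have := k2 i j hj
      have := k3 i j hj
      linarith
    refine ⟨C p p q q, C p q p q, C p q q p, fun i j k l => ?_⟩
    have f1 := hflip i i j k l
    have f2 := hflip j i j k l
    have f3 := hflip k i j k l
    have f4 := hflip l i j k l
    by_cases hij : i = j
    · subst hij
      by_cases hkl : k = l
      · subst hkl
        by_cases hik : i = k
        · subst hik
          simp [k4]
        · simp [hik, k1 i k hik]
      · by_cases hik : i = k
        · subst hik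
          simp [hkl, Ne.symm hkl] at f4 ⊢
          linarith
        · simp [hik, hkl, Ne.symm hik, Ne.symm hkl] at f3 ⊢
          linarith
    · by_cases hik : i = k
      · subst hik
        by_cases hjl : j = l
        · subst hjl
          simp [hij, k2 i j hij]
        · simp [hij, hjl, Ne.symm hij, Ne.symm hjl] at f2 ⊢
          linarith
      · by_cases hil : i = l
        · subst hil
          by_cases hjk : j = k
          · subst hjk
            simp [hij, k3 i j hij]
          · simp [hij, hjk, Ne.symm hij, Ne.symm hjk] at f2 ⊢
            linarith
        · simp [hij, hik, hil] at f1 ⊢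
          linarith
  · push Not at hn
    by_cases h0 : Nonempty (Fin n)
    · obtain ⟨p⟩ := h0
      refine ⟨C p p p p, 0, 0, fun i j k l => ?_⟩
      rw [hn i p, hn j p, hn k p, hn l p]
      simp
    · exact ⟨0, 0, 0, fun i => (h0 ⟨i⟩).elim⟩

/-- The `O(n)`-invariant elements of `⊗⁴ ℝⁿ` are spanned by `ξ₁, ξ₂, ξ₃`. -/
theorem invariant_four_tensor_iff {n : ℕ} (ξ : TPow n 4) :
    (∀ A ∈ Matrix.orthogonalGroup (Fin n) ℝ, tact A ξ = ξ) ↔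
      ξ ∈ Submodule.span ℝ {xi1 n, xi2 n, xi3 n} := by
  simp only [Submodule.mem_span_insert, Submodule.mem_span_singleton]
  constructor
  · intro h
    have hr : ∀ v : Fin n → ℝ, v ⬝ᵥ v ≠ 0 → ∀ a b c d, pairing a b c d ξ =
        pairing ((hhRefl v).mulVec a) ((hhRefl v).mulVec b) ((hhRefl v).mulVec c)
          ((hhRefl v).mulVec d) ξ := by
      intro v hv a b c d
      conv_lhs => rw [← h _ (hhRefl_mem v hv), pairing_tact, hhRefl_transpose]
    have hswap : ∀ p q : Fin n, p ≠ q → ∀ i j k l,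
        pairing (e i) (e j) (e k) (e l) ξ =
        pairing (e (Equiv.swap p q i)) (e (Equiv.swap p q j)) (e (Equiv.swap p q k))
          (e (Equiv.swap p q l)) ξ := by
      intro p q hpq i j k l
      rw [hr (e p - e q) (by
        simp [sub_dotProduct, dotProduct_sub, e_dot, hpq, hpq.symm])]
      simp only [hhRefl_swap _ _ _ hpq]
    have hflip : ∀ m i j k l : Fin n, pairing (e i) (e j) (e k) (e l) ξ =
      (if m = i then (-1 : ℝ) else 1) * (if m = j then (-1 : ℝ) else 1) *
      (if m = k then (-1 : ℝ) else 1) * (if m = l then (-1 : ℝ) else 1) *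
        pairing (e i) (e j) (e k) (e l) ξ := by
      intro m i j k l
      conv_lhs => rw [hr (e m) (by simp [e_dot])]
      rw [hhRefl_flip, hhRefl_flip, hhRefl_flip, hhRefl_flip]
      rw [pairing_hom1, pairing_hom2, pairing_hom3, pairing_hom4]
      ring
    obtain ⟨α, β, γ, hC⟩ := coeffs (fun i j k l => pairing (e i) (e j) (e k) (e l) ξ)
      hflip hswap (by
        intro k l hkl
        have h1 := hr (e k - (2 : ℝ) • e l) (by
          simp [sub_dotProduct, dotProduct_sub, e_dot, hkl, hkl.symm]; norm_num)
          (e k) (e k) (e k) (e k)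
        rw [hhRefl_rot k l hkl] at h1
        simp only [pairing_hom1, pairing_hom2, pairing_hom3, pairing_hom4] at h1
        have s1 := hswap k l hkl k k k k
        have s2 := hswap k l hkl k k l l
        have s3 := hswap k l hkl k l k l
        have s4 := hswap k l hkl k l l k
        have t1 := hflip k k k k l
        have t2 := hflip k k k l k
        have t3 := hflip k k l k k
        have t4 := hflip k l k k k
        have t5 := hflip k k l l l
        have t6 := hflip k l k l l
        have t7 := hflip k l l k l
        have t8 := hflip k l l l k
        simp only [Equiv.swap_apply_left, Equiv.swap_apply_right] at s1 s2 s3 s4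
        simp only [if_true, if_neg hkl] at t1 t2 t3 t4 t5 t6 t7 t8
        show pairing (e k) (e k) (e k) (e k) ξ = _
        linarith)
    refine ⟨α, β • xi2 n + γ • xi3 n, ⟨β, γ • xi3 n, ⟨γ, rfl⟩, rfl⟩, ?_⟩
    apply ext_pairing
    intro i j k l
    have := hC i j k l
    rw [this]
    simp only [map_add, map_smul, pairing_xi1, pairing_xi2, pairing_xi3, e_dot, smul_eq_mul]
    ring
  · rintro ⟨α, _, ⟨β, _, ⟨γ, rfl⟩, rfl⟩, rfl⟩ A hA
    apply ext_pairing
    intro i j k l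
    rw [pairing_tact]
    simp only [map_add, map_smul, pairing_xi1, pairing_xi2, pairing_xi3, orth_dot hA]
end
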